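/- Let Σⁿ ⊂ ℝ^{n+1} be a complete immersed two-sided mean convex self-expander (H > 0, H = ⟨x, ν⟩). On each connected component of the open dense set Σ_A where the number of distinct principal curvatures is locally constant, for a fixed index k with 1 ≤ k < n and φ = φ(λ_k/H) with the Spruck–Xiao cutoff φ, the quantity Lφ := Δφ + ⟨∇φ, x⟩ + 2⟨∇φ, ∇H/H⟩ satisfies Lφ = φ''·|∇(λ_k/H)|² + (2φ'/H)·Σ_{s=1}^{k} Σ_{l : κ_l ≠ κ_s} |∇h_{ls}|²/(κ_s − κ_l). -/

import Mathlib

open scoped RealInnerProductSpace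

noncomputable section

/-! Local-coordinate framework for an immersed hypersurface patch `X : ℝⁿ → ℝ^{n+1}`
with unit normal `ν`: induced metric, second fundamental form, mean curvature,
Christoffel symbols, Laplace–Beltrami operator, and the tangential drift term ⟨∇f, xᵀ⟩. -/

abbrev Euc (n : ℕ) := EuclideanSpace ℝ (Fin n)

/-- `i`-th standard basis vector. -/
def bv (n : ℕ) (i : Fin n) : Euc n := EuclideanSpace.single i 1

/-- Partial derivative of a scalar function. -/
def pd {n : ℕ} (f : Euc n → ℝ) (i : Fin n) (p : Euc n) : ℝ := fderiv ℝ f p (bv n i)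

/-- Partial derivative of a vector-valued function. -/
def pdV {n m : ℕ} (X : Euc n → Euc m) (i : Fin n) (p : Euc n) : Euc m := fderiv ℝ X p (bv n i)

/-- Induced metric g_{ij} = ⟨∂_i X, ∂_j X⟩. -/
def gm {n : ℕ} (X : Euc n → Euc (n + 1)) (i j : Fin n) (p : Euc n) : ℝ :=
  ⟪pdV X i p, pdV X j p⟫

/-- The metric as a matrix. -/
def gMat {n : ℕ} (X : Euc n → Euc (n + 1)) (p : Euc n) : Matrix (Fin n) (Fin n) ℝ :=
  Matrix.of fun i j => gm X i j p

/-- The inverse metric g^{ij}. -/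
def gInv {n : ℕ} (X : Euc n → Euc (n + 1)) (p : Euc n) : Matrix (Fin n) (Fin n) ℝ :=
  (gMat X p)⁻¹

/-- Second fundamental form h_{ij} = ⟨∂_i∂_j X, ν⟩. -/
def sff {n : ℕ} (X ν : Euc n → Euc (n + 1)) (i j : Fin n) (p : Euc n) : ℝ :=
  ⟪pdV (pdV X i) j p, ν p⟫

/-- Mean curvature H = g^{ij} h_{ij}. -/
def meanCurv {n : ℕ} (X ν : Euc n → Euc (n + 1)) (p : Euc n) : ℝ :=
  ∑ i, ∑ j, gInv X p i j * sff X ν i j p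

/-- Squared norm of the second fundamental form |A|² = g^{ia} g^{jb} h_{ij} h_{ab}. -/
def normA2 {n : ℕ} (X ν : Euc n → Euc (n + 1)) (p : Euc n) : ℝ :=
  ∑ i, ∑ j, ∑ a, ∑ b, gInv X p i a * gInv X p j b * sff X ν i j p * sff X ν a b p

/-- Christoffel symbols Γ^k_{ij} = ½ g^{kl} (∂_i g_{jl} + ∂_j g_{il} − ∂_l g_{ij}). -/
def christ {n : ℕ} (X : Euc n → Euc (n + 1)) (k i j : Fin n) (p : Euc n) : ℝ :=
  (1 / 2) * ∑ l, gInv X p k l * (pd (gm X j l) i p + pd (gm X i l) j p - pd (gm X i j) l p)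

/-- Laplace–Beltrami operator Δf = g^{ij} (∂_i∂_j f − Γ^a_{ij} ∂_a f). -/
def lapBel {n : ℕ} (X : Euc n → Euc (n + 1)) (f : Euc n → ℝ) (p : Euc n) : ℝ :=
  ∑ i, ∑ j, gInv X p i j * (pd (pd f j) i p - ∑ a, christ X a i j p * pd f a p)

/-- Drift term ⟨∇f, xᵀ⟩ = g^{ij} ∂_j f ⟨∂_i X, X⟩. -/
def driftTerm {n : ℕ} (X ν : Euc n → Euc (n + 1)) (f : Euc n → ℝ) (p : Euc n) : ℝ :=
  ∑ i, ∑ j, gInv X p i j * pd f j p * ⟪pdV X i p, X p⟫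

/-- Covariant derivative of the second fundamental form:
(∇h)_{kij} = ∂_k h_{ij} − Γ^a_{ki} h_{aj} − Γ^a_{kj} h_{ia}. -/
def covDh {n : ℕ} (X ν : Euc n → Euc (n + 1)) (k i j : Fin n) (p : Euc n) : ℝ :=
  pd (sff X ν i j) k p - (∑ a, christ X a k i p * sff X ν a j p)
    - ∑ a, christ X a k j p * sff X ν i a p

/-- The Spruck–Xiao cutoff function. -/
def phiSX : ℝ → ℝ := fun t => if t < 0 then -t ^ 4 * Real.exp (-1 / t ^ 2) else 0

/-- λ_k = κ₁ + ⋯ + κ_k (0-indexed: the sum of the k smallest principal curvatures). -/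
def lamk {n : ℕ} (κ : Euc n → Fin n → ℝ) (k : ℕ) (p : Euc n) : ℝ :=
  ∑ i ∈ Finset.univ.filter (fun i : Fin n => i.val < k), κ p i

/-- The quotient λ_k/H. -/
def ratk {n : ℕ} (X ν : Euc n → Euc (n + 1)) (κ : Euc n → Fin n → ℝ) (k : ℕ) (p : Euc n) : ℝ :=
  lamk κ k p / meanCurv X ν p

/-- Intrinsic inner product of gradients: ⟨∇f, ∇g⟩ = g^{ij} ∂_i f ∂_j g. -/
def gradSq {n : ℕ} (X : Euc n → Euc (n + 1)) (f g : Euc n → ℝ) (p : Euc n) : ℝ :=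
  ∑ i, ∑ j, gInv X p i j * pd f i p * pd g j p

/-- The operator L f = Δf + ⟨∇f, x⟩ + 2⟨∇f, ∇H/H⟩. -/
def Lop {n : ℕ} (X ν : Euc n → Euc (n + 1)) (f : Euc n → ℝ) (p : Euc n) : ℝ :=
  lapBel X f p + driftTerm X ν f p + 2 * gradSq X f (meanCurv X ν) p / meanCurv X ν p

/-- Number of distinct principal curvatures. -/
def numDistinct {n : ℕ} (κ : Euc n → Fin n → ℝ) (p : Euc n) : ℕ :=
  (Finset.univ.image (κ p)).card

/-- Components of ∇h in the adapted orthonormal eigenframe τ: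
∇_{τ_a} h(τ_l, τ_s) = Σ_{b,c,e} (∇h)_{bce} τ_a^b τ_l^c τ_s^e. -/
def frameDh {n : ℕ} (X ν : Euc n → Euc (n + 1)) (τ : Euc n → Fin n → Fin n → ℝ)
    (a l s : Fin n) (p : Euc n) : ℝ :=
  ∑ b, ∑ c, ∑ e, covDh X ν b c e p * τ p a b * τ p l c * τ p s e

/-- The algebraic core of Simons' identity in a principal frame: `K i j` stands for `∂ᵢ κⱼ`,
`ω i j k` for the connection coefficients, `K2` and `W` for their derivatives. -/
theorem simons_frame_identity {n : ℕ} (κ x : Fin n → ℝ) (H : ℝ) (K : Fin n → Fin n → ℝ)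
    (ω K2 : Fin n → Fin n → Fin n → ℝ) (W : Fin n → Fin n → Fin n → Fin n → ℝ)
    (hω : ∀ i j k, ω i j k = -ω i k j) (hW : ∀ m i j k, W m i j k = -W m i k j)
    (codazzi : ∀ i j k, (if j = k then K i j else 0) + (κ j - κ k) * ω i j k
      = (if i = k then K j i else 0) + (κ i - κ k) * ω j i k)
    (dcodazzi : ∀ m i j k, (if j = k then K2 m i j else 0) + (K m j - K m k) * ω i j k
        + (κ j - κ k) * W m i j k
      = (if i = k then K2 m j i else 0) + (K m i - K m k) * ω j i k + (κ i - κ k) * W m j i k)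
    (gauss : ∀ i j k l, W i j k l - W j i k l
      = ∑ m, (ω i j m - ω j i m) * ω m k l
        + (∑ m, ω j k m * ω i l m + (if j = k then κ j else 0) * (if i = l then κ i else 0))
        - (∑ m, ω i k m * ω j l m + (if i = k then κ i else 0) * (if j = l then κ j else 0)))
    (hκ : ∑ i, κ i = H) (s : Fin n)
    (h1 : ∀ j, ∑ i, K j i = -(κ j * x j))
    (h2 : ∑ i, K2 s s i = -(K s s * x s + κ s * (1 + ∑ l, ω s s l * x l + κ s * H))) :
    ∑ i, (K2 i i s - ∑ l, ω i i l * K l s) + ∑ l, K l s * x l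
      = -((1 + ∑ i, κ i ^ 2) * κ s) + 2 * ∑ l, ∑ a, (κ s - κ l) * ω a l s ^ 2 := by
  have ω0 : ∀ i j, ω i j j = 0 := fun i j => by linarith [hω i j j]
  obtain ⟨t, ht⟩ : ∃ t : Fin n → Fin n → Fin n → ℝ,
      ∀ i j k, t i j k = (if j = k then K i j else 0) + (κ j - κ k) * ω i j k :=
    ⟨_, fun _ _ _ => rfl⟩
  have t12 : ∀ i j k, t i j k = t j i k := fun i j k => by rw [ht, ht]; exact codazzi i j k
  have t23 : ∀ i j k, t i j k = t i k j := fun i j k => by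
    rw [ht, ht, hω i j k]
    by_cases h : j = k
    · subst h; simp
    · simp only [h, Ne.symm h, if_false]; ring
  have hK : ∀ i j, t i j j = K i j := fun i j => by simp [ht]
  have Kt : ∀ i, K i s = (if i = s then K s s else 0) + (κ i - κ s) * ω s i s := fun i => by
    rw [← hK, t12, ht]; split_ifs with h <;> simp [h]
  have qA : ∑ i, ∑ m, (κ i - κ s) * (ω s i m * ω i s m)
      = -(∑ i, ∑ m, (κ m - κ s) * ω i m s ^ 2) + ∑ i, K s i * ω i i s + ∑ i, K i s * ω s i s := by
    have e : ∀ i m, (κ i - κ s) * (ω s i m * ω i s m) = -((κ m - κ s) * ω i m s ^ 2)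
        + (if i = m then K s i * ω i i s else 0) + (if m = s then K i s * ω s i s else 0)
        - ω s i m * t i m s := by
      intro i m
      have a1 := ht s i m
      have a2 := ht i m s
      have a3 : t s i m = t i m s := by rw [t12, t23]
      by_cases h1 : i = m
      · subst h1
        by_cases h2 : i = s
        · subst h2; simp [ω0]
        · simp only [h2, if_true, if_false] at a1 a2 ⊢
          rw [ω0] at a1 ⊢
          linear_combination ω i i s * a1 - ω i i s * a2 - ω i i s * a3
      · by_cases h2 : m = s
        · subst h2
          simp only [h1, if_true, if_false] at a2 ⊢
          rw [ω0] at a2 ⊢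
          linear_combination ω m i m * a2
        · simp only [h1, h2, if_false] at a1 a2 ⊢
          rw [hω i s m]
          linear_combination ω i m s * a1 + (ω s i m - ω i m s) * a2 - ω i m s * a3
    have z : ∑ i, ∑ m, ω s i m * t i m s = 0 := by
      have : ∑ i, ∑ m, ω s i m * t i m s = -∑ i, ∑ m, ω s i m * t i m s := by
        conv_lhs => rw [Finset.sum_comm]
        simp only [← Finset.sum_neg_distrib]
        refine Finset.sum_congr rfl fun i _ => Finset.sum_congr rfl fun m _ => ?_
        rw [hω, t12]; ring
      linarith
    simp only [e, Finset.sum_add_distrib, Finset.sum_sub_distrib, z, Finset.sum_neg_distrib]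
    simp
  have qB : ∑ i, ∑ m, (κ i - κ s) * (ω i s m * ω m i s)
      = -(∑ i, ∑ m, (κ m - κ s) * ω i m s ^ 2) + ∑ i, K i s * ω s i s := by
    have e : ∀ i m, (κ i - κ s) * (ω i s m * ω m i s) = -((κ m - κ s) * ω i m s ^ 2)
        + (if i = s then K m s * ω s m s else 0) := by
      intro i m
      have a1 := ht m i s
      have a2 := ht i m s
      have a3 := t12 m i s
      have a5 := ω0 m s
      by_cases h1 : i = s
      · subst h1
        have := Kt m
        by_cases h2 : m = i
        · subst h2; simp [ω0]
        · simp only [h2, if_true, if_false] at this ⊢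
          rw [a5]
          linear_combination -ω i m i * this
      · by_cases h2 : m = s
        · subst h2
          simp [h1, ω0]
        · simp only [h1, h2, if_false] at a1 a2 ⊢
          rw [hω i s m]
          linear_combination (ω i m s) * a1 - ω i m s * a2 - ω i m s * a3
    simp only [e, Finset.sum_add_distrib, Finset.sum_neg_distrib]
    rw [Finset.sum_comm (f := fun i m => if i = s then K m s * ω s m s else 0)]
    simp
  have qC : ∑ i, ∑ m, (κ i - κ s) * (ω s i m * ω m i s) = ∑ i, K i s * ω s i s := by
    have e : ∀ i m, (κ i - κ s) * (ω s i m * ω m i s) = ω s i m * t m i s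
        + (if i = s then K m s * ω s m s else 0) := by
      intro i m
      rw [ht]
      by_cases h1 : i = s
      · subst h1; simp [hω i i m]; ring
      · simp [h1]; ring
    have z : ∑ i, ∑ m, ω s i m * t m i s = 0 := by
      have : ∑ i, ∑ m, ω s i m * t m i s = -∑ i, ∑ m, ω s i m * t m i s := by
        conv_lhs => rw [Finset.sum_comm]
        simp only [← Finset.sum_neg_distrib]
        refine Finset.sum_congr rfl fun i _ => Finset.sum_congr rfl fun m _ => ?_
        rw [hω, t12]; ring
      linarith
    simp only [e, Finset.sum_add_distrib, z]
    rw [Finset.sum_comm]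
    simp
  have qD : ∑ i, ∑ m, ((κ i - κ s) * (ω i i m * ω s s m) + ω i i m * K m s)
      = ∑ m, κ m * x m * ω s m s + ∑ i, K i i * ω s i s + ∑ i, K s s * ω i i s := by
    have e : ∀ i m, (κ i - κ s) * (ω i i m * ω s s m) + ω i i m * K m s
        = -(K m i * ω s m s) + (if m = i then K i i * ω s i s else 0)
          + (if m = s then K s s * ω i i s else 0) := by
      intro i m
      have a1 := ht i i m
      have a2 : t i i m = K m i := by rw [t23, t12, hK]
      have a3 := Kt m
      rw [a3, hω s s m]
      by_cases h1 : m = i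
      · subst h1
        by_cases h2 : m = s
        · subst h2; simp [ω0]
        · simp [h2, ω0]
      · simp only [h1, Ne.symm h1, if_false] at a1 ⊢
        by_cases h2 : m = s
        · subst h2; simp [ω0]; ring
        · simp only [h2, if_false]
          linear_combination ω s m s * (a1 - a2)
    simp only [e, Finset.sum_add_distrib, Finset.sum_neg_distrib]
    rw [Finset.sum_comm]
    simp only [← Finset.sum_mul, h1]
    simp
  have qx : ∑ l, K l s * x l = K s s * x s
      + ∑ l, (κ l * x l * ω s l s) + κ s * ∑ l, ω s s l * x l := by
    rw [Finset.mul_sum]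
    have e : ∀ l, K l s * x l = (if l = s then K s s * x s else 0) + κ l * x l * ω s l s
        + κ s * (ω s s l * x l) := by
      intro l
      rw [Kt, hω s s l]
      by_cases h : l = s
      · subst h; simp; ring
      · simp [h]; ring
    rw [Finset.sum_congr rfl fun l _ => e l]
    simp only [Finset.sum_add_distrib]
    simp
  have main : ∀ i, K2 i i s = K2 s s i + (K i i * ω s i s - K i s * ω s i s)
      - (K s i * ω i i s - K s s * ω i i s)
      + (∑ m, (κ i - κ s) * (ω i s m * ω m i s) - ∑ m, (κ i - κ s) * (ω s i m * ω m i s)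
        + ∑ m, (κ i - κ s) * (ω s i m * ω i s m) - ∑ m, (κ i - κ s) * (ω i i m * ω s s m)
        - (κ i ^ 2 * κ s - κ s ^ 2 * κ i)) := by
    intro i
    have a := dcodazzi i i s s
    have b := dcodazzi s i s i
    have g := gauss i s i s
    simp only [sub_mul, Finset.sum_sub_distrib] at g
    simp only [if_true] at a b g
    rw [hω i s i, hW s i s i] at b
    simp only [← Finset.mul_sum]
    by_cases h : i = s
    · subst h; simp
    · simp only [h, Ne.symm h, if_false] at a b g
      linear_combination a + b + (κ i - κ s) * g
  have swap : ∑ l, ∑ a, (κ s - κ l) * ω a l s ^ 2 = -∑ i, ∑ m, (κ m - κ s) * ω i m s ^ 2 := by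
    rw [Finset.sum_comm]
    simp only [← Finset.sum_neg_distrib]
    refine Finset.sum_congr rfl fun i _ => Finset.sum_congr rfl fun m _ => ?_
    ring
  simp only [Finset.sum_add_distrib] at qD
  rw [← Finset.mul_sum (a := K s s)] at qD
  rw [Finset.sum_sub_distrib, Finset.sum_congr rfl fun i _ => main i]
  simp only [Finset.sum_add_distrib, Finset.sum_sub_distrib]
  have hκ' : ∑ i, κ s ^ 2 * κ i = κ s ^ 2 * H := by rw [← Finset.mul_sum, hκ]
  rw [qA, qB, qC, h2, qx, swap, ← Finset.sum_mul, ← Finset.mul_sum, hκ']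
  linear_combination -qD

/-- Derivative of `F` along the vector field `V`. -/
def dirD {n : ℕ} {G : Type*} [NormedAddCommGroup G] [NormedSpace ℝ G]
    (V : Euc n → Euc n) (F : Euc n → G) (p : Euc n) : G := fderiv ℝ F p (V p)

section dirD

variable {n : ℕ} {G : Type*} [NormedAddCommGroup G] [NormedSpace ℝ G]
  {Ω : Set (Euc n)} {p : Euc n} {V : Euc n → Euc n}

theorem dirD_congr (hΩ : IsOpen Ω) (hp : p ∈ Ω) {F F' : Euc n → G}
    (h : ∀ q ∈ Ω, F q = F' q) : dirD V F p = dirD V F' p := by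
  unfold dirD
  rw [Filter.EventuallyEq.fderiv_eq (Filter.eventuallyEq_of_mem (hΩ.mem_nhds hp) h)]

theorem ContDiffOn.dirD (hΩ : IsOpen Ω) {F : Euc n → G}
    (hF : ContDiffOn ℝ (⊤ : ℕ∞) F Ω) (hV : ContDiffOn ℝ (⊤ : ℕ∞) V Ω) :
    ContDiffOn ℝ (⊤ : ℕ∞) (dirD V F) Ω :=
  (hF.fderiv_of_isOpen hΩ (m := ((⊤ : ℕ∞) : WithTop ℕ∞)) (by simp)).clm_apply hV

theorem ContDiffOn.differentiableAt_of_isOpen (hΩ : IsOpen Ω) (hp : p ∈ Ω) {F : Euc n → G}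
    (hF : ContDiffOn ℝ (⊤ : ℕ∞) F Ω) : DifferentiableAt ℝ F p :=
  (hF.contDiffAt (hΩ.mem_nhds hp)).differentiableAt (by simp)

theorem dirD_add {F F' : Euc n → G} (hF : DifferentiableAt ℝ F p)
    (hF' : DifferentiableAt ℝ F' p) :
    dirD V (fun q => F q + F' q) p = dirD V F p + dirD V F' p := by
  unfold dirD
  rw [fderiv_fun_add hF hF']; rfl

theorem dirD_const (c : G) : dirD V (fun _ => c) p = 0 := by
  simp [dirD]

theorem dirD_sum {ι : Type*} {s : Finset ι} {F : ι → Euc n → G}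
    (hF : ∀ i ∈ s, DifferentiableAt ℝ (F i) p) :
    dirD V (fun q => ∑ i ∈ s, F i q) p = ∑ i ∈ s, dirD V (F i) p := by
  unfold dirD
  rw [fderiv_fun_sum hF]; simp

theorem dirD_mul {f g : Euc n → ℝ} (hf : DifferentiableAt ℝ f p) (hg : DifferentiableAt ℝ g p) :
    dirD V (fun q => f q * g q) p = dirD V f p * g p + f p * dirD V g p := by
  unfold dirD
  rw [fderiv_fun_mul hf hg]
  simp; ring

theorem dirD_inner {m : ℕ} {F F' : Euc n → Euc m} (hF : DifferentiableAt ℝ F p)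
    (hF' : DifferentiableAt ℝ F' p) :
    dirD V (fun q => ⟪F q, F' q⟫) p = ⟪dirD V F p, F' p⟫ + ⟪F p, dirD V F' p⟫ := by
  unfold dirD
  rw [fderiv_inner_apply ℝ hF hF']; ring

theorem dirD_comp {φ : ℝ → ℝ} {f : Euc n → ℝ} (hφ : DifferentiableAt ℝ φ (f p))
    (hf : DifferentiableAt ℝ f p) :
    dirD V (fun q => φ (f q)) p = deriv φ (f p) * dirD V f p := by
  unfold dirD
  have := (hφ.hasDerivAt.comp_hasFDerivAt p hf.hasFDerivAt).fderiv
  rw [Function.comp_def] at this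
  rw [this]; simp

theorem dirD_dirD_of_differentiableAt {F : Euc n → G} {U : Euc n → Euc n}
    (hU : DifferentiableAt ℝ U p) (hF : DifferentiableAt ℝ (fderiv ℝ F) p) :
    dirD V (dirD U F) p = fderiv ℝ (fderiv ℝ F) p (V p) (U p) + fderiv ℝ F p (dirD V U p) := by
  unfold dirD
  rw [fderiv_clm_apply hF hU]
  simp [add_comm]

theorem differentiableAt_fderiv (hΩ : IsOpen Ω) (hp : p ∈ Ω) {F : Euc n → G}
    (hF : ContDiffOn ℝ (⊤ : ℕ∞) F Ω) : DifferentiableAt ℝ (fderiv ℝ F) p :=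
  (hF.fderiv_of_isOpen hΩ (m := ((⊤ : ℕ∞) : WithTop ℕ∞)) (by simp)).differentiableAt_of_isOpen hΩ hp

theorem dirD_dirD (hΩ : IsOpen Ω) (hp : p ∈ Ω) {F : Euc n → G} {U : Euc n → Euc n}
    (hU : ContDiffOn ℝ (⊤ : ℕ∞) U Ω) (hF : ContDiffOn ℝ (⊤ : ℕ∞) F Ω) :
    dirD V (dirD U F) p = fderiv ℝ (fderiv ℝ F) p (V p) (U p) + fderiv ℝ F p (dirD V U p) :=
  dirD_dirD_of_differentiableAt (hU.differentiableAt_of_isOpen hΩ hp)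
    (differentiableAt_fderiv hΩ hp hF)

theorem fderiv_fderiv_symm (hΩ : IsOpen Ω) (hp : p ∈ Ω) {F : Euc n → G}
    (hF : ContDiffOn ℝ (⊤ : ℕ∞) F Ω) (v w : Euc n) :
    fderiv ℝ (fderiv ℝ F) p v w = fderiv ℝ (fderiv ℝ F) p w v :=
  ((hF.contDiffAt (hΩ.mem_nhds hp)).isSymmSndFDerivAt
    (by simpa using WithTop.coe_le_coe.2 (le_top : (2 : ℕ∞) ≤ ⊤))).eq v w

end dirD

/-- `n` orthonormal vectors together with a unit normal are complete in `ℝⁿ⁺¹`. -/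
theorem inner_eq_sum_frame {n : ℕ} {e : Fin n → Euc (n + 1)} {N : Euc (n + 1)}
    (he : ∀ i j, ⟪e i, e j⟫ = if i = j then (1 : ℝ) else 0) (hN : ⟪N, N⟫ = (1 : ℝ))
    (hNe : ∀ i, ⟪N, e i⟫ = (0 : ℝ)) (v w : Euc (n + 1)) :
    ⟪v, w⟫ = ∑ i, ⟪v, e i⟫ * ⟪w, e i⟫ + ⟪v, N⟫ * ⟪w, N⟫ := by
  have ho : Orthonormal ℝ (Fin.snoc (α := fun _ => Euc (n + 1)) e N) := by
    rw [orthonormal_iff_ite]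
    intro i j
    refine Fin.lastCases ?_ (fun i => ?_) i <;> refine Fin.lastCases ?_ (fun j => ?_) j
    · simp only [Fin.snoc_last, if_true, hN]
    · simp only [Fin.snoc_last, Fin.snoc_castSucc, hNe, (Fin.castSucc_lt_last j).ne', if_false]
    · simp only [Fin.snoc_last, Fin.snoc_castSucc, real_inner_comm, hNe,
        (Fin.castSucc_lt_last i).ne, if_false]
    · simp only [Fin.snoc_castSucc, he, Fin.castSucc_inj]
  let b := (basisOfOrthonormalOfCardEqFinrank ho (by simp)).toOrthonormalBasis
    (by simpa using ho)
  have hb : ⇑b = Fin.snoc (α := fun _ => Euc (n + 1)) e N := by simp [b]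
  rw [← b.sum_inner_mul_inner v w, Fin.sum_univ_castSucc]
  simp only [hb, Fin.snoc_castSucc, Fin.snoc_last]
  congr 1
  · exact Finset.sum_congr rfl fun i _ => by rw [real_inner_comm w]
  · rw [real_inner_comm w]

/-- A moving frame `T` along an immersed hypersurface `X` with unit normal `ν` which is orthonormal
for the induced metric and consists of principal directions. -/
structure IsPrincipalFrame {n : ℕ} (X ν : Euc n → Euc (n + 1)) (κ : Fin n → Euc n → ℝ)
    (T : Fin n → Euc n → Euc n) (Ω : Set (Euc n)) : Prop where
  isOpen : IsOpen Ω
  contDiffOn_X : ContDiffOn ℝ (⊤ : ℕ∞) X Ω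
  contDiffOn_ν : ContDiffOn ℝ (⊤ : ℕ∞) ν Ω
  contDiffOn_κ : ∀ i, ContDiffOn ℝ (⊤ : ℕ∞) (κ i) Ω
  contDiffOn_T : ∀ i, ContDiffOn ℝ (⊤ : ℕ∞) (T i) Ω
  orthonormal : ∀ p ∈ Ω, ∀ i j, ⟪dirD (T i) X p, dirD (T j) X p⟫ = if i = j then (1 : ℝ) else 0
  normal_unit : ∀ p ∈ Ω, ⟪ν p, ν p⟫ = (1 : ℝ)
  normal_orth : ∀ p ∈ Ω, ∀ i, ⟪ν p, dirD (T i) X p⟫ = (0 : ℝ)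
  principal : ∀ p ∈ Ω, ∀ i j,
    ⟪dirD (T i) (dirD (T j) X) p, ν p⟫ = if i = j then κ i p else 0

/-- Connection coefficients `⟨∇_{T i} T j, T k⟩` of a moving frame. -/
def connCoeff {n : ℕ} (X : Euc n → Euc (n + 1)) (T : Fin n → Euc n → Euc n) (i j k : Fin n)
    (p : Euc n) : ℝ :=
  ⟪dirD (T i) (dirD (T j) X) p, dirD (T k) X p⟫

namespace IsPrincipalFrame

variable {n : ℕ} {X ν : Euc n → Euc (n + 1)} {κ : Fin n → Euc n → ℝ}
  {T : Fin n → Euc n → Euc n} {Ω : Set (Euc n)} {p : Euc n}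

theorem contDiffOn_frame (h : IsPrincipalFrame X ν κ T Ω) (i : Fin n) :
    ContDiffOn ℝ (⊤ : ℕ∞) (dirD (T i) X) Ω :=
  h.contDiffOn_X.dirD h.isOpen (h.contDiffOn_T i)

theorem contDiffOn_connCoeff (h : IsPrincipalFrame X ν κ T Ω) (i j k : Fin n) :
    ContDiffOn ℝ (⊤ : ℕ∞) (connCoeff X T i j k) Ω :=
  ((h.contDiffOn_frame j).dirD h.isOpen (h.contDiffOn_T i)).inner ℝ (h.contDiffOn_frame k)

theorem inner_eq (h : IsPrincipalFrame X ν κ T Ω) (hp : p ∈ Ω) (v w : Euc (n + 1)) :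
    ⟪v, w⟫ = ∑ i, ⟪v, dirD (T i) X p⟫ * ⟪w, dirD (T i) X p⟫ + ⟪v, ν p⟫ * ⟪w, ν p⟫ :=
  inner_eq_sum_frame (e := fun i => dirD (T i) X p) (h.orthonormal p hp) (h.normal_unit p hp)
    (h.normal_orth p hp) v w

theorem eq_sum_inner_smul (h : IsPrincipalFrame X ν κ T Ω) (hp : p ∈ Ω) (v : Euc n) :
    v = ∑ l, ⟪fderiv ℝ X p v, dirD (T l) X p⟫ • T l p := by
  have key : ∀ (c : Fin n → ℝ) j,
      ⟪fderiv ℝ X p (∑ l, c l • T l p), dirD (T j) X p⟫ = c j := by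
    intro c j
    simp only [map_sum, map_smul, sum_inner, inner_smul_left]
    change ∑ l, c l * ⟪dirD (T l) X p, dirD (T j) X p⟫ = _
    simp [h.orthonormal p hp]
  have hli : LinearIndependent ℝ fun l => T l p := by
    rw [Fintype.linearIndependent_iff]
    intro c hc j
    rw [← key c j, hc]; simp
  have hspan := hli.span_eq_top_of_card_eq_finrank' (by simp)
  have hv : v ∈ Submodule.span ℝ (Set.range fun l => T l p) := hspan ▸ Submodule.mem_top
  obtain ⟨c, rfl⟩ := (Submodule.mem_span_range_iff_exists_fun ℝ).1 hv
  simp only [key]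

theorem connCoeff_antisymm (h : IsPrincipalFrame X ν κ T Ω) (hp : p ∈ Ω) (i j k : Fin n) :
    connCoeff X T i j k p = -connCoeff X T i k j p := by
  have := dirD_congr (V := T i) h.isOpen hp (fun q hq => h.orthonormal q hq j k)
  rw [dirD_const, dirD_inner ((h.contDiffOn_frame j).differentiableAt_of_isOpen h.isOpen hp)
    ((h.contDiffOn_frame k).differentiableAt_of_isOpen h.isOpen hp),
    real_inner_comm (dirD (T i) _ p)] at this
  unfold connCoeff
  linarith

theorem inner_dirD_normal (h : IsPrincipalFrame X ν κ T Ω) (hp : p ∈ Ω) (i j : Fin n) :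
    ⟪dirD (T i) ν p, dirD (T j) X p⟫ = -(if i = j then κ i p else 0) := by
  have := dirD_congr (V := T i) h.isOpen hp (fun q hq => h.normal_orth q hq j)
  rw [dirD_const, dirD_inner (h.contDiffOn_ν.differentiableAt_of_isOpen h.isOpen hp)
    ((h.contDiffOn_frame j).differentiableAt_of_isOpen h.isOpen hp),
    real_inner_comm (dirD (T i) _ p), h.principal p hp] at this
  linarith

theorem inner_dirD_normal_normal (h : IsPrincipalFrame X ν κ T Ω) (hp : p ∈ Ω) (i : Fin n) :
    ⟪dirD (T i) ν p, ν p⟫ = (0 : ℝ) := by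
  have := dirD_congr (V := T i) h.isOpen hp (fun q hq => h.normal_unit q hq)
  have hd := h.contDiffOn_ν.differentiableAt_of_isOpen h.isOpen hp
  rw [dirD_const, dirD_inner hd hd, real_inner_comm (dirD (T i) _ p)] at this
  linarith

theorem dirD_comm (h : IsPrincipalFrame X ν κ T Ω) (hp : p ∈ Ω) {G : Type*}
    [NormedAddCommGroup G] [NormedSpace ℝ G] {F : Euc n → G} (hF : ContDiffOn ℝ (⊤ : ℕ∞) F Ω)
    (i j : Fin n) :
    dirD (T i) (dirD (T j) F) p = dirD (T j) (dirD (T i) F) p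
      + ∑ l, (connCoeff X T i j l p - connCoeff X T j i l p) • dirD (T l) F p := by
  have e : dirD (T i) (T j) p = dirD (T j) (T i) p
      + ∑ l, (connCoeff X T i j l p - connCoeff X T j i l p) • T l p := by
    rw [← sub_eq_iff_eq_add']
    conv_lhs => rw [h.eq_sum_inner_smul hp (dirD (T i) (T j) p - dirD (T j) (T i) p)]
    refine Finset.sum_congr rfl fun l _ => ?_
    rw [map_sub, inner_sub_left, connCoeff, connCoeff,
      dirD_dirD h.isOpen hp (h.contDiffOn_T j) h.contDiffOn_X,
      dirD_dirD h.isOpen hp (h.contDiffOn_T i) h.contDiffOn_X,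
      fderiv_fderiv_symm h.isOpen hp h.contDiffOn_X (T i p), inner_add_left, inner_add_left]
    congr 1; ring
  rw [dirD_dirD h.isOpen hp (h.contDiffOn_T j) hF, dirD_dirD h.isOpen hp (h.contDiffOn_T i) hF, e,
    fderiv_fderiv_symm h.isOpen hp hF (T i p), map_add, map_sum, ← add_assoc]
  simp only [map_smul]
  rfl

theorem codazzi (h : IsPrincipalFrame X ν κ T Ω) (hp : p ∈ Ω) (i j k : Fin n) :
    (if j = k then dirD (T i) (κ j) p else 0) + (κ j p - κ k p) * connCoeff X T i j k p
      = (if i = k then dirD (T j) (κ i) p else 0)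
        + (κ i p - κ k p) * connCoeff X T j i k p := by
  have key : ∀ i j, ⟪dirD (T i) (dirD (T j) ν) p, dirD (T k) X p⟫
      = -(if j = k then dirD (T i) (κ j) p else 0) - κ j p * connCoeff X T i j k p := by
    intro i j
    have := dirD_congr (V := T i) h.isOpen hp (fun q hq => h.inner_dirD_normal hq j k)
    rw [dirD_inner ((h.contDiffOn_ν.dirD h.isOpen
      (h.contDiffOn_T j)).differentiableAt_of_isOpen h.isOpen hp)
      ((h.contDiffOn_frame k).differentiableAt_of_isOpen h.isOpen hp),
      h.inner_eq hp (dirD (T j) ν p), h.inner_dirD_normal_normal hp] at this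
    have e : dirD (T i) (fun q => -(if j = k then κ j q else 0)) p
        = -(if j = k then dirD (T i) (κ j) p else 0) := by
      split_ifs
      · simp [dirD]
      · simp [dirD_const]
    rw [e] at this
    simp only [h.inner_dirD_normal hp, neg_mul, ite_mul, zero_mul, Finset.sum_neg_distrib,
      Finset.sum_ite_eq, Finset.mem_univ, if_true, add_zero] at this
    have a := h.connCoeff_antisymm hp i j k
    simp only [connCoeff] at a ⊢
    rw [a]
    linarith
  have c := congrArg (fun v => ⟪v, dirD (T k) X p⟫) (h.dirD_comm hp h.contDiffOn_ν i j)
  simp only [inner_add_left, key, sum_inner, inner_smul_left, h.inner_dirD_normal hp] at c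
  simp at c
  linarith

theorem gauss (h : IsPrincipalFrame X ν κ T Ω) (hp : p ∈ Ω) (i j k l : Fin n) :
    dirD (T i) (connCoeff X T j k l) p - dirD (T j) (connCoeff X T i k l) p
      = ∑ m, (connCoeff X T i j m p - connCoeff X T j i m p) * connCoeff X T m k l p
        + (∑ m, connCoeff X T j k m p * connCoeff X T i l m p
          + (if j = k then κ j p else 0) * (if i = l then κ i p else 0))
        - (∑ m, connCoeff X T i k m p * connCoeff X T j l m p
          + (if i = k then κ i p else 0) * (if j = l then κ j p else 0)) := by
  have key : ∀ i j, dirD (T i) (connCoeff X T j k l) p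
      = ⟪dirD (T i) (dirD (T j) (dirD (T k) X)) p, dirD (T l) X p⟫
        + (∑ m, connCoeff X T j k m p * connCoeff X T i l m p
          + (if j = k then κ j p else 0) * (if i = l then κ i p else 0)) := by
    intro i j
    unfold connCoeff
    rw [dirD_inner (((h.contDiffOn_frame k).dirD h.isOpen
      (h.contDiffOn_T j)).differentiableAt_of_isOpen h.isOpen hp)
      ((h.contDiffOn_frame l).differentiableAt_of_isOpen h.isOpen hp),
      h.inner_eq hp (dirD (T j) (dirD (T k) X) p), h.principal p hp, h.principal p hp]
  have c := congrArg (fun v => ⟪v, dirD (T l) X p⟫) (h.dirD_comm hp (h.contDiffOn_frame k) i j)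
  simp only [inner_add_left, sum_inner, inner_smul_left] at c
  rw [key, key, c]
  simp only [connCoeff, conj_trivial]
  ring

/-- The evolution-type equation for the principal curvatures of a self-expander. -/
theorem drift_laplacian_principal (h : IsPrincipalFrame X ν κ T Ω)
    (hexp : ∀ p ∈ Ω, ∑ i, κ i p = ⟪X p, ν p⟫) (hp : p ∈ Ω) (s : Fin n) :
    ∑ i, (dirD (T i) (dirD (T i) (κ s)) p
        - ∑ l, connCoeff X T i i l p * dirD (T l) (κ s) p)
      + ∑ l, dirD (T l) (κ s) p * ⟪X p, dirD (T l) X p⟫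
      = -((1 + ∑ i, κ i p ^ 2) * κ s p)
        + 2 * ∑ l, ∑ a, (κ s p - κ l p) * connCoeff X T a l s p ^ 2 := by
  have dX := h.contDiffOn_X.differentiableAt_of_isOpen h.isOpen hp
  have dκ := fun i => (h.contDiffOn_κ i).differentiableAt_of_isOpen h.isOpen hp
  have dω := fun i j k => (h.contDiffOn_connCoeff i j k).differentiableAt_of_isOpen h.isOpen hp
  have dDκ := fun i j => ((h.contDiffOn_κ j).dirD h.isOpen
    (h.contDiffOn_T i)).differentiableAt_of_isOpen h.isOpen hp
  have de := fun i => (h.contDiffOn_frame i).differentiableAt_of_isOpen h.isOpen hp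
  have h1 : ∀ q ∈ Ω, ∀ j, ∑ i, dirD (T j) (κ i) q = -(κ j q * ⟪X q, dirD (T j) X q⟫) := by
    intro q hq j
    rw [← dirD_sum fun i _ => (h.contDiffOn_κ i).differentiableAt_of_isOpen h.isOpen hq,
      dirD_congr h.isOpen hq hexp,
      dirD_inner (h.contDiffOn_X.differentiableAt_of_isOpen h.isOpen hq)
        (h.contDiffOn_ν.differentiableAt_of_isOpen h.isOpen hq), real_inner_comm,
      h.normal_orth q hq, h.inner_eq hq (X q), h.inner_dirD_normal_normal hq]
    simp [h.inner_dirD_normal hq, mul_comm]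
  refine simons_frame_identity (fun i => κ i p) (fun l => ⟪X p, dirD (T l) X p⟫) ⟪X p, ν p⟫
    (fun i j => dirD (T i) (κ j) p) (fun i j k => connCoeff X T i j k p)
    (fun i j k => dirD (T i) (dirD (T j) (κ k)) p)
    (fun m i j k => dirD (T m) (connCoeff X T i j k) p)
    (h.connCoeff_antisymm hp) ?_ (h.codazzi hp) ?_ (h.gauss hp) (hexp p hp) s (h1 p hp) ?_
  · intro m i j k
    rw [dirD_congr h.isOpen hp fun q hq => h.connCoeff_antisymm hq i j k]
    simp [dirD]
  · have e : ∀ m i j k, dirD (T m) (fun q => (if j = k then dirD (T i) (κ j) q else 0)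
        + (κ j q - κ k q) * connCoeff X T i j k q) p
        = (if j = k then dirD (T m) (dirD (T i) (κ j)) p else 0)
          + (dirD (T m) (κ j) p - dirD (T m) (κ k) p) * connCoeff X T i j k p
          + (κ j p - κ k p) * dirD (T m) (connCoeff X T i j k) p := by
      intro m i j k
      have hsub : dirD (T m) (fun q => κ j q - κ k q) p
          = dirD (T m) (κ j) p - dirD (T m) (κ k) p := by
        unfold dirD; rw [fderiv_fun_sub (dκ j) (dκ k)]; rfl
      have dsub : DifferentiableAt ℝ (fun q => κ j q - κ k q) p := (dκ j).sub (dκ k)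
      rw [dirD_add, dirD_mul dsub (dω i j k), hsub, add_assoc]
      · congr 1
        split_ifs
        · rfl
        · exact dirD_const 0
      · split_ifs
        · exact dDκ i j
        · exact differentiableAt_const _
      · exact dsub.mul (dω i j k)
    intro m i j k
    rw [← e, ← e]
    exact dirD_congr h.isOpen hp fun q hq => h.codazzi hq i j k
  · rw [← dirD_sum fun i _ => dDκ s i, dirD_congr h.isOpen hp fun q hq => h1 q hq s]
    have : dirD (T s) (fun q => -(κ s q * ⟪X q, dirD (T s) X q⟫)) p
        = -dirD (T s) (fun q => κ s q * ⟪X q, dirD (T s) X q⟫) p := by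
      simp [dirD]
    rw [this, dirD_mul (dκ s) (dX.inner ℝ (de s)), dirD_inner dX (de s), h.orthonormal p hp,
      h.inner_eq hp (X p) (dirD (T s) (dirD (T s) X) p), h.principal p hp]
    simp [connCoeff, mul_comm, add_assoc]

end IsPrincipalFrame

/-- The drift Laplacian `Δf + ⟨∇f, X⟩` expressed in a moving frame. -/
def frameDriftLap {n : ℕ} (X : Euc n → Euc (n + 1)) (T : Fin n → Euc n → Euc n) (f : Euc n → ℝ)
    (p : Euc n) : ℝ :=
  ∑ i, (dirD (T i) (dirD (T i) f) p - ∑ l, connCoeff X T i i l p * dirD (T l) f p)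
    + ∑ l, dirD (T l) f p * ⟪X p, dirD (T l) X p⟫

section frameDriftLap

variable {n : ℕ} {X : Euc n → Euc (n + 1)} {T : Fin n → Euc n → Euc n} {Ω : Set (Euc n)}
  {p : Euc n} {f g : Euc n → ℝ}

theorem frameDriftLap_congr (hΩ : IsOpen Ω) (hp : p ∈ Ω) (h : ∀ q ∈ Ω, f q = g q) :
    frameDriftLap X T f p = frameDriftLap X T g p := by
  have h1 : ∀ i, ∀ q ∈ Ω, dirD (T i) f q = dirD (T i) g q := fun i q hq => dirD_congr hΩ hq h
  unfold frameDriftLap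
  simp only [h1 _ p hp, dirD_congr hΩ hp (h1 _)]

theorem frameDriftLap_sum (hΩ : IsOpen Ω) (hp : p ∈ Ω)
    (hT : ∀ i, ContDiffOn ℝ (⊤ : ℕ∞) (T i) Ω) {ι : Type*} {s : Finset ι} {F : ι → Euc n → ℝ}
    (hF : ∀ j ∈ s, ContDiffOn ℝ (⊤ : ℕ∞) (F j) Ω) :
    frameDriftLap X T (fun q => ∑ j ∈ s, F j q) p = ∑ j ∈ s, frameDriftLap X T (F j) p := by
  have h1 : ∀ i, ∀ q ∈ Ω, dirD (T i) (fun q => ∑ j ∈ s, F j q) q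
      = ∑ j ∈ s, dirD (T i) (F j) q := fun i q hq =>
    dirD_sum fun j hj => (hF j hj).differentiableAt_of_isOpen hΩ hq
  have h2 : ∀ i, dirD (T i) (dirD (T i) fun q => ∑ j ∈ s, F j q) p
      = ∑ j ∈ s, dirD (T i) (dirD (T i) (F j)) p := fun i => by
    rw [dirD_congr hΩ hp (h1 i), dirD_sum fun j hj =>
      ((hF j hj).dirD hΩ (hT i)).differentiableAt_of_isOpen hΩ hp]
  unfold frameDriftLap
  simp only [h1 _ p hp, h2, Finset.sum_add_distrib, Finset.sum_sub_distrib, Finset.mul_sum,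
    Finset.sum_mul]
  congr 1
  · congr 1
    · exact Finset.sum_comm
    · rw [Finset.sum_comm (s := s)]
      exact Finset.sum_congr rfl fun _ _ => Finset.sum_comm
  · exact Finset.sum_comm

theorem frameDriftLap_mul (hΩ : IsOpen Ω) (hp : p ∈ Ω)
    (hT : ∀ i, ContDiffOn ℝ (⊤ : ℕ∞) (T i) Ω) (hf : ContDiffOn ℝ (⊤ : ℕ∞) f Ω)
    (hg : ContDiffOn ℝ (⊤ : ℕ∞) g Ω) :
    frameDriftLap X T (fun q => f q * g q) p = frameDriftLap X T f p * g p
      + f p * frameDriftLap X T g p + 2 * ∑ i, dirD (T i) f p * dirD (T i) g p := by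
  have h1 : ∀ i, ∀ q ∈ Ω, dirD (T i) (fun q => f q * g q) q
      = dirD (T i) f q * g q + f q * dirD (T i) g q := fun i q hq =>
    dirD_mul (hf.differentiableAt_of_isOpen hΩ hq) (hg.differentiableAt_of_isOpen hΩ hq)
  have h2 : ∀ i, dirD (T i) (dirD (T i) fun q => f q * g q) p
      = dirD (T i) (dirD (T i) f) p * g p + f p * dirD (T i) (dirD (T i) g) p
        + 2 * (dirD (T i) f p * dirD (T i) g p) := fun i => by
    have df := hf.differentiableAt_of_isOpen hΩ hp
    have dg := hg.differentiableAt_of_isOpen hΩ hp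
    have ddf := (hf.dirD hΩ (hT i)).differentiableAt_of_isOpen hΩ hp
    have ddg := (hg.dirD hΩ (hT i)).differentiableAt_of_isOpen hΩ hp
    have d1 : DifferentiableAt ℝ (fun q => dirD (T i) f q * g q) p := ddf.mul dg
    have d2 : DifferentiableAt ℝ (fun q => f q * dirD (T i) g q) p := df.mul ddg
    rw [dirD_congr hΩ hp (h1 i), dirD_add d1 d2, dirD_mul ddf dg, dirD_mul df ddg]
    ring
  unfold frameDriftLap
  simp only [h1 _ p hp, h2, add_mul, mul_add, Finset.mul_sum, Finset.sum_mul,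
    ← Finset.sum_add_distrib, sub_mul, mul_sub]
  refine Finset.sum_congr rfl fun i _ => ?_
  simp only [Finset.sum_add_distrib, mul_assoc, mul_left_comm (f p), mul_comm _ (g p),
    mul_left_comm (g p)]
  ring

theorem frameDriftLap_comp (hΩ : IsOpen Ω) (hp : p ∈ Ω)
    (hT : ∀ i, ContDiffOn ℝ (⊤ : ℕ∞) (T i) Ω) (hf : ContDiffOn ℝ (⊤ : ℕ∞) f Ω)
    {φ : ℝ → ℝ} (hφ : Differentiable ℝ φ) (hφ' : Differentiable ℝ (deriv φ)) :
    frameDriftLap X T (fun q => φ (f q)) p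
      = deriv (deriv φ) (f p) * ∑ i, dirD (T i) f p * dirD (T i) f p
        + deriv φ (f p) * frameDriftLap X T f p := by
  have h1 : ∀ i, ∀ q ∈ Ω, dirD (T i) (fun q => φ (f q)) q
      = deriv φ (f q) * dirD (T i) f q := fun i q hq =>
    dirD_comp hφ.differentiableAt (hf.differentiableAt_of_isOpen hΩ hq)
  have h2 : ∀ i, dirD (T i) (dirD (T i) fun q => φ (f q)) p
      = deriv (deriv φ) (f p) * (dirD (T i) f p * dirD (T i) f p)
        + deriv φ (f p) * dirD (T i) (dirD (T i) f) p := fun i => by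
    have df := hf.differentiableAt_of_isOpen hΩ hp
    have ddf := (hf.dirD hΩ (hT i)).differentiableAt_of_isOpen hΩ hp
    have d1 : DifferentiableAt ℝ (fun q => deriv φ (f q)) p := hφ'.differentiableAt.comp p df
    rw [dirD_congr hΩ hp (h1 i), dirD_mul d1 ddf, dirD_comp hφ'.differentiableAt df]
    ring
  unfold frameDriftLap
  simp only [h1 _ p hp, h2, mul_add, Finset.mul_sum, ← Finset.sum_add_distrib, mul_sub]
  refine Finset.sum_congr rfl fun i _ => ?_
  simp only [mul_assoc, mul_left_comm _ (deriv φ (f p))]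
  ring

end frameDriftLap

theorem sum_sum_sub_mul_sq_eq_zero {ι : Type*} [Fintype ι] (κ : ι → ℝ) (c : ι → ι → ι → ℝ)
    (hc : ∀ a l s, c a l s = -c a s l) :
    ∑ s, ∑ l, ∑ a, (κ s - κ l) * c a l s ^ 2 = 0 := by
  have : ∑ s, ∑ l, ∑ a, (κ s - κ l) * c a l s ^ 2
      = -∑ s, ∑ l, ∑ a, (κ s - κ l) * c a l s ^ 2 := by
    conv_lhs => rw [Finset.sum_comm]
    simp only [← Finset.sum_neg_distrib]
    refine Finset.sum_congr rfl fun i _ => Finset.sum_congr rfl fun m _ =>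
      Finset.sum_congr rfl fun a _ => ?_
    rw [hc a m i]; ring
  linarith

namespace IsPrincipalFrame

variable {n : ℕ} {X ν : Euc n → Euc (n + 1)} {κ : Fin n → Euc n → ℝ}
  {T : Fin n → Euc n → Euc n} {Ω : Set (Euc n)} {p : Euc n}

theorem drift_laplacian_comp_ratio (h : IsPrincipalFrame X ν κ T Ω)
    (hexp : ∀ p ∈ Ω, ∑ i, κ i p = ⟪X p, ν p⟫) {H : Euc n → ℝ} (hH : ∀ p ∈ Ω, H p = ∑ i, κ i p)
    (hpos : ∀ p ∈ Ω, 0 < H p) (S : Finset (Fin n)) {f : Euc n → ℝ}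
    (hf : ∀ p ∈ Ω, f p = (∑ s ∈ S, κ s p) / H p)
    {φ : ℝ → ℝ} (hφ : Differentiable ℝ φ) (hφ' : Differentiable ℝ (deriv φ)) (hp : p ∈ Ω) :
    frameDriftLap X T (fun q => φ (f q)) p
        + 2 * (∑ i, dirD (T i) (fun q => φ (f q)) p * dirD (T i) H p) / H p
      = deriv (deriv φ) (f p) * ∑ i, dirD (T i) f p * dirD (T i) f p
        + (2 * deriv φ (f p) / H p)
          * ∑ s ∈ S, ∑ l, ∑ a, (κ s p - κ l p) * connCoeff X T a l s p ^ 2 := by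
  have sH : ContDiffOn ℝ (⊤ : ℕ∞) H Ω :=
    (ContDiffOn.sum fun i _ => h.contDiffOn_κ i).congr fun q hq => hH q hq
  have sf : ContDiffOn ℝ (⊤ : ℕ∞) f Ω :=
    ((ContDiffOn.sum fun i _ => h.contDiffOn_κ i).div sH fun q hq => (hpos q hq).ne').congr
      fun q hq => hf q hq
  have df := sf.differentiableAt_of_isOpen h.isOpen hp
  have hH0 := (hpos p hp).ne'
  have Lκ := fun s => h.drift_laplacian_principal hexp hp s
  have LS : ∀ S : Finset (Fin n), frameDriftLap X T (fun q => ∑ s ∈ S, κ s q) p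
      = -((1 + ∑ i, κ i p ^ 2) * ∑ s ∈ S, κ s p)
        + 2 * ∑ s ∈ S, ∑ l, ∑ a, (κ s p - κ l p) * connCoeff X T a l s p ^ 2 := by
    intro S
    rw [frameDriftLap_sum h.isOpen hp h.contDiffOn_T fun j _ => h.contDiffOn_κ j, Finset.mul_sum,
      ← Finset.sum_neg_distrib, Finset.mul_sum, ← Finset.sum_add_distrib]
    exact Finset.sum_congr rfl fun s _ => Lκ s
  have LH := LS Finset.univ
  rw [sum_sum_sub_mul_sq_eq_zero (fun i => κ i p) (fun a l s => connCoeff X T a l s p)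
    (fun a l s => h.connCoeff_antisymm hp a l s), ← frameDriftLap_congr h.isOpen hp hH,
    ← hH p hp] at LH
  have Lf := frameDriftLap_mul (X := X) h.isOpen hp h.contDiffOn_T sf sH
  have e : ∀ q ∈ Ω, f q * H q = ∑ s ∈ S, κ s q := fun q hq => by
    rw [hf q hq, div_mul_cancel₀ _ (hpos q hq).ne']
  rw [frameDriftLap_congr h.isOpen hp e, LS, LH, ← e p hp] at Lf
  rw [frameDriftLap_comp h.isOpen hp h.contDiffOn_T sf hφ hφ']
  have hD : ∑ i, dirD (T i) (fun q => φ (f q)) p * dirD (T i) H p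
      = deriv φ (f p) * ∑ i, dirD (T i) f p * dirD (T i) H p := by
    rw [Finset.mul_sum]
    exact Finset.sum_congr rfl fun i _ => by rw [dirD_comp hφ.differentiableAt df, mul_assoc]
  rw [hD]
  field_simp
  linear_combination (-deriv φ (f p)) * Lf

end IsPrincipalFrame

theorem hasDerivAt_exp_neg_inv_sq_cutoff {P P' : ℝ → ℝ} (hP : ∀ t, HasDerivAt P (P' t) t) (t : ℝ) :
    HasDerivAt (fun t => if t < 0 then P t * Real.exp (-1 / t ^ 2) else 0)
      (if t < 0 then (P' t + P t * (2 / t ^ 3)) * Real.exp (-1 / t ^ 2) else 0) t := by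
  rcases lt_trichotomy t 0 with ht | rfl | ht
  · have hne : t ≠ 0 := ht.ne
    rw [if_pos ht]
    have h1 : HasDerivAt (fun t : ℝ => -1 / t ^ 2) (2 / t ^ 3) t := by
      refine ((hasDerivAt_const t (-1 : ℝ)).div (hasDerivAt_pow 2 t) (by positivity)).congr_deriv ?_
      push_cast
      field_simp
      ring
    refine (((hP t).mul h1.exp).congr_of_eventuallyEq ?_).congr_deriv ?_
    · filter_upwards [eventually_lt_nhds ht] with x hx
      simp [hx]
    · ring
  · rw [if_neg (lt_irrefl _)]
    refine HasDerivAt.of_isLittleO ?_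
    have hO : (fun t => if t < 0 then P t * Real.exp (-1 / t ^ 2) else 0)
        =O[nhds 0] fun t : ℝ => t ^ 2 := by
      have hPb : P =O[nhds 0] fun _ => (1 : ℝ) := (hP 0).continuousAt.isBigO_one ℝ
      refine Asymptotics.IsBigO.trans (g := fun t => P t * t ^ 2) ?_ ?_
      · refine Asymptotics.IsBigO.of_bound 1 (Filter.Eventually.of_forall fun x => ?_)
        split_ifs with hx
        · rw [one_mul, norm_mul, norm_mul]
          refine mul_le_mul_of_nonneg_left ?_ (norm_nonneg _)
          have hx2 : 0 < x ^ 2 := by have := hx.ne; positivity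
          rw [Real.norm_of_nonneg (Real.exp_pos _).le, Real.norm_of_nonneg hx2.le, neg_div,
            Real.exp_neg, inv_le_comm₀ (Real.exp_pos _) hx2]
          have := Real.add_one_le_exp (1 / x ^ 2)
          rw [one_div] at this ⊢
          linarith
        · rw [norm_zero]
          positivity
      · simpa using hPb.mul (Asymptotics.isBigO_refl (fun t : ℝ => t ^ 2) (nhds 0))
    have ho := hO.trans_isLittleO (Asymptotics.isLittleO_pow_id (𝕜 := ℝ) one_lt_two)
    simpa using ho
  · rw [if_neg ht.not_gt]
    refine (hasDerivAt_const t (0 : ℝ)).congr_of_eventuallyEq ?_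
    filter_upwards [eventually_gt_nhds ht] with x hx
    simp [hx.not_gt]

theorem hasDerivAt_phiSX (t : ℝ) :
    HasDerivAt phiSX (if t < 0 then (-4 * t ^ 3 - 2 * t) * Real.exp (-1 / t ^ 2) else 0) t := by
  have := hasDerivAt_exp_neg_inv_sq_cutoff (P := fun t => -t ^ 4) (P' := fun t => -(4 * t ^ 3))
    (fun t => (hasDerivAt_pow 4 t).neg.congr_deriv (by norm_num)) t
  refine this.congr_deriv ?_
  split_ifs with ht
  · have := ht.ne
    congr 1
    field_simp
    ring
  · rfl

theorem differentiable_phiSX : Differentiable ℝ phiSX := fun t =>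
  (hasDerivAt_phiSX t).differentiableAt

theorem differentiable_deriv_phiSX : Differentiable ℝ (deriv phiSX) := by
  rw [funext fun t => (hasDerivAt_phiSX t).deriv]
  refine fun t => (hasDerivAt_exp_neg_inv_sq_cutoff (P := fun t => -4 * t ^ 3 - 2 * t)
    (P' := fun t => -4 * (3 * t ^ 2) - 2) (fun t => ?_) t).differentiableAt
  exact (((hasDerivAt_pow 3 t).const_mul (-4)).sub ((hasDerivAt_id t).const_mul 2)).congr_deriv
    (by norm_num)

section coordinates

variable {n m : ℕ} {G : Type*} [NormedAddCommGroup G] [NormedSpace ℝ G]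

theorem sum_smul_map_bv (L : Euc n →L[ℝ] G) (v : Euc n) : ∑ a, v a • L (bv n a) = L v := by
  have : ∑ a, v a • bv n a = v := by
    ext b
    simp [bv, Finset.sum_apply, Pi.single_apply]
  conv_rhs => rw [← this]
  simp

theorem sum_map_bv_mul (L : Euc n →L[ℝ] ℝ) (v : Euc n) : ∑ a, L (bv n a) * v a = L v := by
  rw [← sum_smul_map_bv L v]
  exact Finset.sum_congr rfl fun a _ => mul_comm _ _

theorem sum_inner_map_bv_mul (L : Euc n →L[ℝ] Euc m) (w : Euc m) (v : Euc n) :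
    ∑ a, ⟪L (bv n a), w⟫ * v a = ⟪L v, w⟫ := by
  rw [← sum_smul_map_bv L v, sum_inner]
  exact Finset.sum_congr rfl fun a _ => by rw [inner_smul_left, mul_comm]; rfl

theorem sum_sum_map_bv_mul (B : Euc n →L[ℝ] Euc n →L[ℝ] ℝ) (u v : Euc n) :
    ∑ a, ∑ b, B (bv n a) (bv n b) * u a * v b = B u v := by
  rw [← sum_smul_map_bv B u, sum_apply]
  refine Finset.sum_congr rfl fun a _ => ?_
  rw [smul_apply, ← sum_map_bv_mul (B (bv n a)) v, smul_eq_mul, Finset.mul_sum]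
  exact Finset.sum_congr rfl fun b _ => by ring

theorem sum_sum_inner_map_bv_mul (B : Euc n →L[ℝ] Euc n →L[ℝ] Euc m) (w : Euc m) (u v : Euc n) :
    ∑ a, ∑ b, ⟪B (bv n a) (bv n b), w⟫ * u a * v b = ⟪B u v, w⟫ := by
  rw [← sum_smul_map_bv B u, sum_apply, sum_inner]
  refine Finset.sum_congr rfl fun a _ => ?_
  rw [smul_apply, inner_smul_left, ← sum_inner_map_bv_mul (B (bv n a)) w v,
    Finset.mul_sum]
  exact Finset.sum_congr rfl fun b _ => by rw [conj_trivial]; ring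

theorem sum_sum_gm_mul {X : Euc n → Euc (n + 1)} {p : Euc n} (u v : Euc n) :
    ∑ a, ∑ b, gm X a b p * u a * v b = ⟪fderiv ℝ X p u, fderiv ℝ X p v⟫ := by
  rw [← sum_inner_map_bv_mul (fderiv ℝ X p) _ u]
  refine Finset.sum_congr rfl fun a _ => ?_
  rw [real_inner_comm, ← sum_inner_map_bv_mul (fderiv ℝ X p) _ v, Finset.sum_mul]
  refine Finset.sum_congr rfl fun b _ => ?_
  rw [real_inner_comm]
  simp only [gm, pdV]
  ring

theorem pd_pd {f : Euc n → ℝ} {p : Euc n} (hf : DifferentiableAt ℝ (fderiv ℝ f) p) (i j : Fin n) :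
    pd (pd f j) i p = fderiv ℝ (fderiv ℝ f) p (bv n i) (bv n j) := by
  have := dirD_dirD_of_differentiableAt (V := fun _ => bv n i) (differentiableAt_const (bv n j)) hf
  rwa [dirD_const, map_zero, add_zero] at this

theorem pdV_pdV {X : Euc n → Euc m} {p : Euc n} (hX : DifferentiableAt ℝ (fderiv ℝ X) p)
    (i j : Fin n) : pdV (pdV X j) i p = fderiv ℝ (fderiv ℝ X) p (bv n i) (bv n j) := by
  have := dirD_dirD_of_differentiableAt (V := fun _ => bv n i) (differentiableAt_const (bv n j)) hX
  rwa [dirD_const, map_zero, add_zero] at this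

theorem sum_pd_mul {f : Euc n → ℝ} {T : Euc n → Euc n} {p : Euc n} :
    ∑ a, pd f a p * T p a = dirD T f p :=
  sum_map_bv_mul _ _

theorem gInv_eq_sum {X : Euc n → Euc (n + 1)} {p : Euc n} {t : Fin n → Fin n → ℝ}
    (ht : ∀ i j, ∑ a, ∑ b, gm X a b p * t i a * t j b = if i = j then (1 : ℝ) else 0)
    (a b : Fin n) : gInv X p a b = ∑ m, t m a * t m b := by
  have h1 : Matrix.of t * (gMat X p * (Matrix.of t).transpose) = 1 := by
    ext i j
    simp only [Matrix.mul_apply, gMat, Matrix.of_apply, Matrix.transpose_apply, Matrix.one_apply,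
      ← ht, Finset.mul_sum]
    exact Finset.sum_congr rfl fun a _ => Finset.sum_congr rfl fun b _ => by ring
  have h2 : gMat X p * ((Matrix.of t).transpose * Matrix.of t) = 1 := by
    rw [← Matrix.mul_assoc]
    exact mul_eq_one_comm.1 h1
  rw [gInv, Matrix.inv_eq_right_inv h2]
  simp [Matrix.mul_apply]

theorem sum_sum_gInv_mul {X : Euc n → Euc (n + 1)} {p : Euc n} {t : Fin n → Fin n → ℝ}
    (ht : ∀ i j, ∑ a, ∑ b, gm X a b p * t i a * t j b = if i = j then (1 : ℝ) else 0)
    (F : Fin n → Fin n → ℝ) :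
    ∑ i, ∑ j, gInv X p i j * F i j = ∑ m, ∑ i, ∑ j, F i j * t m i * t m j := by
  simp only [gInv_eq_sum ht, Finset.sum_mul]
  refine ((Finset.sum_congr rfl fun i _ => Finset.sum_comm).trans Finset.sum_comm).trans ?_
  exact Finset.sum_congr rfl fun m _ => Finset.sum_congr rfl fun i _ =>
    Finset.sum_congr rfl fun j _ => by ring

end coordinates

namespace IsPrincipalFrame

variable {n : ℕ} {X ν : Euc n → Euc (n + 1)} {κ : Fin n → Euc n → ℝ}
  {T : Fin n → Euc n → Euc n} {Ω : Set (Euc n)} {p : Euc n}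

theorem inner_normal_fderiv (h : IsPrincipalFrame X ν κ T Ω) (hp : p ∈ Ω) (v : Euc n) :
    ⟪ν p, fderiv ℝ X p v⟫ = (0 : ℝ) := by
  have := h.normal_orth p hp
  unfold dirD at this
  rw [h.eq_sum_inner_smul hp v]
  simp [inner_sum, inner_smul_right, this]

theorem inner_fderiv_fderiv_normal (h : IsPrincipalFrame X ν κ T Ω) (hp : p ∈ Ω) (i : Fin n)
    (v : Euc n) :
    ⟪fderiv ℝ (fderiv ℝ X) p (T i p) v, ν p⟫ = κ i p * ⟪fderiv ℝ X p v, dirD (T i) X p⟫ := by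
  have key : ∀ l, ⟪fderiv ℝ (fderiv ℝ X) p (T i p) (T l p), ν p⟫ = if i = l then κ i p else 0 := by
    intro l
    rw [← h.principal p hp, dirD_dirD h.isOpen hp (h.contDiffOn_T l) h.contDiffOn_X, inner_add_left,
      real_inner_comm _ (fderiv ℝ X p _), h.inner_normal_fderiv hp, add_zero]
  conv_lhs => rw [h.eq_sum_inner_smul hp v]
  simp [sum_inner, inner_smul_left, key, mul_comm]

theorem sum_sum_gm (h : IsPrincipalFrame X ν κ T Ω) (hp : p ∈ Ω) (i j : Fin n) :
    ∑ a, ∑ b, gm X a b p * T i p a * T j p b = if i = j then (1 : ℝ) else 0 := by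
  rw [sum_sum_gm_mul]
  exact h.orthonormal p hp i j

theorem gradSq_eq (h : IsPrincipalFrame X ν κ T Ω) (hp : p ∈ Ω) (f g : Euc n → ℝ) :
    gradSq X f g p = ∑ i, dirD (T i) f p * dirD (T i) g p := by
  simp only [gradSq, mul_assoc]
  rw [sum_sum_gInv_mul (h.sum_sum_gm hp)]
  refine Finset.sum_congr rfl fun m _ => ?_
  rw [← sum_pd_mul, ← sum_pd_mul, Finset.sum_mul_sum]
  exact Finset.sum_congr rfl fun i _ => Finset.sum_congr rfl fun j _ => by ring

theorem driftTerm_eq (h : IsPrincipalFrame X ν κ T Ω) (hp : p ∈ Ω) (f : Euc n → ℝ) :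
    driftTerm X ν f p = ∑ i, dirD (T i) f p * ⟪X p, dirD (T i) X p⟫ := by
  simp only [driftTerm, mul_assoc]
  rw [sum_sum_gInv_mul (h.sum_sum_gm hp)]
  refine Finset.sum_congr rfl fun m _ => ?_
  rw [← sum_pd_mul, real_inner_comm, dirD, ← sum_inner_map_bv_mul, Finset.sum_mul_sum,
    Finset.sum_comm]
  refine Finset.sum_congr rfl fun i _ => Finset.sum_congr rfl fun j _ => ?_
  simp only [pdV]
  ring

theorem meanCurv_eq (h : IsPrincipalFrame X ν κ T Ω) (hp : p ∈ Ω) :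
    meanCurv X ν p = ∑ i, κ i p := by
  rw [meanCurv, sum_sum_gInv_mul (h.sum_sum_gm hp)]
  refine Finset.sum_congr rfl fun m _ => ?_
  simp only [sff, pdV_pdV (differentiableAt_fderiv h.isOpen hp h.contDiffOn_X)]
  rw [Finset.sum_comm]
  have := sum_sum_inner_map_bv_mul (fderiv ℝ (fderiv ℝ X) p) (ν p) (T m p) (T m p)
  rw [h.inner_fderiv_fderiv_normal hp] at this
  have o := h.orthonormal p hp m m
  rw [if_pos rfl] at o
  rw [← dirD, o, mul_one] at this
  rw [← this]
  exact Finset.sum_congr rfl fun i _ => Finset.sum_congr rfl fun j _ => by ring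

theorem christ_eq (h : IsPrincipalFrame X ν κ T Ω) (hp : p ∈ Ω) (k i j : Fin n) :
    christ X k i j p
      = ∑ m, T m p k * ⟪fderiv ℝ (fderiv ℝ X) p (bv n i) (bv n j), dirD (T m) X p⟫ := by
  have dX := differentiableAt_fderiv h.isOpen hp h.contDiffOn_X
  have key : ∀ i j l, pd (gm X j l) i p
      = ⟪fderiv ℝ (fderiv ℝ X) p (bv n i) (bv n j), pdV X l p⟫
        + ⟪fderiv ℝ (fderiv ℝ X) p (bv n i) (bv n l), pdV X j p⟫ := by
    intro i j l
    have d : ∀ j, DifferentiableAt ℝ (pdV X j) p := fun j =>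
      dX.clm_apply (differentiableAt_const _)
    have := dirD_inner (V := fun _ => bv n i) (d j) (d l)
    rw [← pdV_pdV dX, ← pdV_pdV dX, real_inner_comm (pdV X j p)]
    exact this
  have sy := fderiv_fderiv_symm h.isOpen hp h.contDiffOn_X
  have e : ∀ l, pd (gm X j l) i p + pd (gm X i l) j p - pd (gm X i j) l p
      = 2 * ⟪fderiv ℝ (fderiv ℝ X) p (bv n i) (bv n j), pdV X l p⟫ := by
    intro l
    rw [key, key, key, sy (bv n j) (bv n i), sy (bv n l) (bv n i), sy (bv n l) (bv n j)]
    ring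
  simp only [christ, e, gInv_eq_sum (h.sum_sum_gm hp), Finset.sum_mul, Finset.mul_sum]
  rw [Finset.sum_comm]
  refine Finset.sum_congr rfl fun m _ => ?_
  rw [real_inner_comm, dirD, ← sum_inner_map_bv_mul, Finset.mul_sum]
  refine Finset.sum_congr rfl fun l _ => ?_
  rw [real_inner_comm]
  simp only [pdV]
  ring

theorem sum_christ_mul (h : IsPrincipalFrame X ν κ T Ω) (hp : p ∈ Ω) (i j : Fin n)
    (y : Fin n → ℝ) :
    ∑ a, christ X a i j p * y a
      = ∑ m, ⟪fderiv ℝ (fderiv ℝ X) p (bv n i) (bv n j), dirD (T m) X p⟫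
          * ∑ a, y a * T m p a := by
  simp only [h.christ_eq hp, Finset.sum_mul, Finset.mul_sum]
  rw [Finset.sum_comm]
  exact Finset.sum_congr rfl fun m _ => Finset.sum_congr rfl fun a _ => by ring

theorem connCoeff_eq (h : IsPrincipalFrame X ν κ T Ω) (hp : p ∈ Ω) (i j k : Fin n) :
    connCoeff X T i j k p = ⟪fderiv ℝ (fderiv ℝ X) p (T i p) (T j p), dirD (T k) X p⟫
      + ⟪fderiv ℝ X p (dirD (T i) (T j) p), dirD (T k) X p⟫ := by
  rw [connCoeff, dirD_dirD h.isOpen hp (h.contDiffOn_T j) h.contDiffOn_X, inner_add_left]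

theorem lapBel_add_driftTerm (h : IsPrincipalFrame X ν κ T Ω) (hp : p ∈ Ω) {f : Euc n → ℝ}
    (hf : DifferentiableAt ℝ (fderiv ℝ f) p) :
    lapBel X f p + driftTerm X ν f p = frameDriftLap X T f p := by
  rw [h.driftTerm_eq hp, frameDriftLap]
  congr 1
  rw [lapBel, sum_sum_gInv_mul (h.sum_sum_gm hp)]
  refine Finset.sum_congr rfl fun m _ => ?_
  have e : dirD (T m) (dirD (T m) f) p - ∑ l, connCoeff X T m m l p * dirD (T l) f p
      = fderiv ℝ (fderiv ℝ f) p (T m p) (T m p)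
        - ∑ l, ⟪fderiv ℝ (fderiv ℝ X) p (T m p) (T m p), dirD (T l) X p⟫ * dirD (T l) f p := by
    have hT := congrArg (fderiv ℝ f p) (h.eq_sum_inner_smul hp (dirD (T m) (T m) p))
    rw [map_sum] at hT
    simp only [map_smul, smul_eq_mul] at hT
    rw [dirD_dirD_of_differentiableAt ((h.contDiffOn_T m).differentiableAt_of_isOpen h.isOpen hp)
      hf, hT]
    simp only [h.connCoeff_eq hp, add_mul, Finset.sum_add_distrib]
    simp only [dirD]
    ring
  rw [e, ← sum_sum_map_bv_mul]
  have e' := fun l => (sum_sum_inner_map_bv_mul (fderiv ℝ (fderiv ℝ X) p) (dirD (T l) X p)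
    (T m p) (T m p)).symm
  simp only [sub_mul, Finset.sum_sub_distrib, pd_pd hf, h.sum_christ_mul hp, sum_pd_mul, e',
    Finset.sum_mul]
  congr 1
  refine ((Finset.sum_congr rfl fun i _ => Finset.sum_comm).trans Finset.sum_comm).trans ?_
  exact Finset.sum_congr rfl fun m _ => Finset.sum_congr rfl fun i _ =>
    Finset.sum_congr rfl fun j _ => by ring

theorem sum_sff_mul (h : IsPrincipalFrame X ν κ T Ω) (hp : p ∈ Ω) (m b : Fin n) :
    ∑ a, sff X ν a b p * T m p a = κ m p * ⟪pdV X b p, dirD (T m) X p⟫ := by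
  have dX := differentiableAt_fderiv h.isOpen hp h.contDiffOn_X
  rw [pdV, ← h.inner_fderiv_fderiv_normal hp,
    fderiv_fderiv_symm h.isOpen hp h.contDiffOn_X, ← sum_inner_map_bv_mul]
  simp only [sff, pdV_pdV dX]

theorem sff_symm (h : IsPrincipalFrame X ν κ T Ω) (hp : p ∈ Ω) (a b : Fin n) :
    sff X ν a b p = sff X ν b a p := by
  have dX := differentiableAt_fderiv h.isOpen hp h.contDiffOn_X
  rw [sff, sff, pdV_pdV dX, pdV_pdV dX, fderiv_fderiv_symm h.isOpen hp h.contDiffOn_X]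

theorem sum_sff_mul_right (h : IsPrincipalFrame X ν κ T Ω) (hp : p ∈ Ω) (m b : Fin n) :
    ∑ a, sff X ν b a p * T m p a = κ m p * ⟪pdV X b p, dirD (T m) X p⟫ := by
  rw [← h.sum_sff_mul hp]
  exact Finset.sum_congr rfl fun a _ => by rw [h.sff_symm hp]

theorem contDiffOn_sff (h : IsPrincipalFrame X ν κ T Ω) (a b : Fin n) :
    ContDiffOn ℝ (⊤ : ℕ∞) (sff X ν a b) Ω :=
  ((h.contDiffOn_X.dirD h.isOpen (contDiffOn_const (c := bv n a))).dirD h.isOpen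
    (contDiffOn_const (c := bv n b))).inner ℝ h.contDiffOn_ν

theorem sum_sum_sff_mul (h : IsPrincipalFrame X ν κ T Ω) (hp : p ∈ Ω) (l s : Fin n) :
    ∑ c, ∑ e, sff X ν c e p * T l p c * T s p e = if l = s then κ l p else 0 := by
  have e : κ l p * ⟪dirD (T s) X p, dirD (T l) X p⟫ = if l = s then κ l p else 0 := by
    rw [h.orthonormal p hp]
    split_ifs with h1 h2 h2 <;> simp_all
  rw [← e, dirD, ← sum_inner_map_bv_mul, Finset.sum_comm, Finset.mul_sum]
  refine Finset.sum_congr rfl fun b _ => ?_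
  rw [← Finset.sum_mul, h.sum_sff_mul hp, pdV, mul_assoc]

theorem sum_dirD_sff_mul (h : IsPrincipalFrame X ν κ T Ω) (hp : p ∈ Ω) (a l s : Fin n) :
    ∑ c, ∑ e, dirD (T a) (sff X ν c e) p * T l p c * T s p e
      = (if l = s then dirD (T a) (κ l) p else 0)
        - κ s p * ⟪fderiv ℝ X p (dirD (T a) (T l) p), dirD (T s) X p⟫
        - κ l p * ⟪fderiv ℝ X p (dirD (T a) (T s) p), dirD (T l) X p⟫ := by
  have key := dirD_congr (V := T a) h.isOpen hp fun q hq => h.sum_sum_sff_mul hq l s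
  have e1 : dirD (T a) (fun q => if l = s then κ l q else 0) p
      = if l = s then dirD (T a) (κ l) p else 0 := by
    split_ifs
    · rfl
    · exact dirD_const 0
  have dT : ∀ i, DifferentiableAt ℝ (T i) p := fun i =>
    (h.contDiffOn_T i).differentiableAt_of_isOpen h.isOpen hp
  have dTc : ∀ i c, DifferentiableAt ℝ (fun q => T i q c) p := fun i c =>
    differentiableAt_euclidean.1 (dT i) c
  have eT : ∀ i c, dirD (T a) (fun q => T i q c) p = dirD (T a) (T i) p c := fun i c => by
    have := ((EuclideanSpace.proj (𝕜 := ℝ) c).hasFDerivAt.comp p (dT i).hasFDerivAt).fderiv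
    exact congrArg (fun L : Euc n →L[ℝ] ℝ => L (T a p)) this
  have dh : ∀ c e, DifferentiableAt ℝ (sff X ν c e) p := fun c e =>
    (h.contDiffOn_sff c e).differentiableAt_of_isOpen h.isOpen hp
  have d1 : ∀ c e, DifferentiableAt ℝ (fun q => sff X ν c e q * T l q c) p := fun c e =>
    (dh c e).mul (dTc l c)
  have d2 : ∀ c e, DifferentiableAt ℝ (fun q => sff X ν c e q * T l q c * T s q e) p := fun c e =>
    (d1 c e).mul (dTc s e)
  have e2 : dirD (T a) (fun q => ∑ c, ∑ e, sff X ν c e q * T l q c * T s q e) p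
      = ∑ c, ∑ e, (dirD (T a) (sff X ν c e) p * T l p c * T s p e
        + sff X ν c e p * dirD (T a) (T l) p c * T s p e
        + sff X ν c e p * T l p c * dirD (T a) (T s) p e) := by
    rw [dirD_sum fun c _ => DifferentiableAt.fun_sum fun e _ => d2 c e]
    refine Finset.sum_congr rfl fun c _ => ?_
    rw [dirD_sum fun e _ => d2 c e]
    refine Finset.sum_congr rfl fun e _ => ?_
    rw [dirD_mul (d1 c e) (dTc s e), dirD_mul (dh c e) (dTc l c), eT, eT, add_mul]
  have e3 : ∑ c, ∑ e, sff X ν c e p * dirD (T a) (T l) p c * T s p e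
      = κ s p * ⟪fderiv ℝ X p (dirD (T a) (T l) p), dirD (T s) X p⟫ := by
    rw [← sum_inner_map_bv_mul, Finset.mul_sum]
    refine Finset.sum_congr rfl fun c _ => ?_
    rw [← mul_assoc, ← pdV, ← h.sum_sff_mul_right hp, Finset.sum_mul]
    exact Finset.sum_congr rfl fun e _ => by ring
  have e4 : ∑ c, ∑ e, sff X ν c e p * T l p c * dirD (T a) (T s) p e
      = κ l p * ⟪fderiv ℝ X p (dirD (T a) (T s) p), dirD (T l) X p⟫ := by
    rw [← sum_inner_map_bv_mul, Finset.mul_sum, Finset.sum_comm]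
    refine Finset.sum_congr rfl fun e _ => ?_
    rw [← mul_assoc, ← pdV, ← h.sum_sff_mul hp, Finset.sum_mul]
  rw [e2, e1] at key
  simp only [Finset.sum_add_distrib] at key
  rw [e3, e4] at key
  linarith

theorem sum_christ_sff_mul (h : IsPrincipalFrame X ν κ T Ω) (hp : p ∈ Ω) (a l s : Fin n) :
    ∑ b, ∑ c, ∑ e, (∑ d, christ X d b c p * sff X ν d e p) * T a p b * T l p c * T s p e
      = κ s p * ⟪fderiv ℝ (fderiv ℝ X) p (T a p) (T l p), dirD (T s) X p⟫ := by
  have e1 : ∀ b c, ∑ e, (∑ d, christ X d b c p * sff X ν d e p) * T a p b * T l p c * T s p e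
      = κ s p
        * (⟪fderiv ℝ (fderiv ℝ X) p (bv n b) (bv n c), dirD (T s) X p⟫ * T a p b * T l p c) := by
    intro b c
    have e2 : ∑ e, (∑ d, christ X d b c p * sff X ν d e p) * T s p e
        = κ s p * ⟪fderiv ℝ (fderiv ℝ X) p (bv n b) (bv n c), dirD (T s) X p⟫ := by
      simp only [h.sum_christ_mul hp, Finset.sum_mul]
      rw [Finset.sum_comm]
      simp only [mul_assoc, ← Finset.mul_sum]
      have e3 : ∀ m, ∑ e, (∑ d, sff X ν d e p * T m p d) * T s p e
          = if m = s then κ m p else 0 := by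
        intro m
        rw [← h.sum_sum_sff_mul hp, Finset.sum_comm]
        exact Finset.sum_congr rfl fun e _ => Finset.sum_mul _ _ _
      simp only [e3, mul_ite, mul_zero, Finset.sum_ite_eq', Finset.mem_univ, if_true]
      ring
    rw [← mul_assoc, ← mul_assoc, ← e2, Finset.sum_mul, Finset.sum_mul]
    exact Finset.sum_congr rfl fun e _ => by ring
  simp only [e1, ← Finset.mul_sum]
  rw [sum_sum_inner_map_bv_mul]

theorem frameDh_eq (h : IsPrincipalFrame X ν κ T Ω) (hp : p ∈ Ω) (a l s : Fin n) :
    frameDh X ν (fun q i => T i q) a l s p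
      = (if l = s then dirD (T a) (κ l) p else 0)
        + (κ l p - κ s p) * connCoeff X T a l s p := by
  have e1 : ∑ b, ∑ c, ∑ e, pd (sff X ν c e) b p * T a p b * T l p c * T s p e
      = ∑ c, ∑ e, dirD (T a) (sff X ν c e) p * T l p c * T s p e := by
    refine (Finset.sum_comm.trans (Finset.sum_congr rfl fun c _ => Finset.sum_comm)).trans ?_
    refine Finset.sum_congr rfl fun c _ => Finset.sum_congr rfl fun e _ => ?_
    rw [← sum_pd_mul, Finset.sum_mul, Finset.sum_mul]
  have e2 : ∑ b, ∑ c, ∑ e, (∑ d, christ X d b e p * sff X ν c d p) * T a p b * T l p c * T s p e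
      = κ l p * ⟪fderiv ℝ (fderiv ℝ X) p (T a p) (T s p), dirD (T l) X p⟫ := by
    rw [← h.sum_christ_sff_mul hp]
    refine Finset.sum_congr rfl fun b _ => ?_
    rw [Finset.sum_comm]
    refine Finset.sum_congr rfl fun e _ => Finset.sum_congr rfl fun c _ => ?_
    simp only [h.sff_symm hp c]
    ring
  simp only [frameDh, covDh, sub_mul, Finset.sum_sub_distrib]
  rw [e1, e2, h.sum_christ_sff_mul hp, h.sum_dirD_sff_mul hp]
  have c1 := h.connCoeff_eq hp a l s
  have c2 := h.connCoeff_eq hp a s l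
  have c3 := h.connCoeff_antisymm hp a l s
  rw [c3]
  linear_combination κ s p * c1 + κ l p * c2 - κ s p * c3

end IsPrincipalFrame

theorem isPrincipalFrame_of_coordinates {n : ℕ} {X ν : Euc n → Euc (n + 1)} {Ω : Set (Euc n)}
    (hΩ : IsOpen Ω) (hX : ContDiff ℝ (⊤ : ℕ∞) X) (hν : ContDiff ℝ (⊤ : ℕ∞) ν)
    (hunit : ∀ p ∈ Ω, ‖ν p‖ = 1) (horth : ∀ p ∈ Ω, ∀ i, ⟪ν p, pdV X i p⟫ = (0 : ℝ))
    {κ : Euc n → Fin n → ℝ} (hκ : ∀ i, ContDiffOn ℝ (⊤ : ℕ∞) (fun p => κ p i) Ω)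
    {τ : Euc n → Fin n → Fin n → ℝ} (hτ : ∀ i a, ContDiffOn ℝ (⊤ : ℕ∞) (fun p => τ p i a) Ω)
    (hτorth : ∀ p ∈ Ω, ∀ i j,
      (∑ a, ∑ b, gm X a b p * τ p i a * τ p j b) = if i = j then (1 : ℝ) else 0)
    (hτeig : ∀ p ∈ Ω, ∀ i b,
      (∑ a, sff X ν a b p * τ p i a) = κ p i * ∑ a, gm X a b p * τ p i a) :
    IsPrincipalFrame X ν (fun i p => κ p i) (fun i p => WithLp.toLp 2 (τ p i)) Ω := by
  set T : Fin n → Euc n → Euc n := fun i p => WithLp.toLp 2 (τ p i) with hT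
  have sT : ∀ i, ContDiffOn ℝ (⊤ : ℕ∞) (T i) Ω := fun i =>
    contDiffOn_euclidean.2 fun a => hτ i a
  have hN : ∀ p ∈ Ω, ∀ v, ⟪ν p, fderiv ℝ X p v⟫ = (0 : ℝ) := by
    intro p hp v
    rw [real_inner_comm, ← sum_inner_map_bv_mul]
    refine Finset.sum_eq_zero fun a _ => ?_
    rw [real_inner_comm, ← pdV, horth p hp, zero_mul]
  refine ⟨hΩ, hX.contDiffOn, hν.contDiffOn, hκ, sT, fun p hp i j => ?_, fun p hp => ?_,
    fun p hp i => hN p hp _, fun p hp i j => ?_⟩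
  · rw [dirD, dirD, ← sum_sum_gm_mul]
    exact hτorth p hp i j
  · rw [real_inner_self_eq_norm_sq, hunit p hp, one_pow]
  · rw [dirD_dirD hΩ hp (sT j) hX.contDiffOn, inner_add_left, real_inner_comm _ (fderiv ℝ X p _),
      hN p hp, add_zero, ← sum_sum_inner_map_bv_mul]
    simp only [← pdV_pdV (differentiableAt_fderiv hΩ hp hX.contDiffOn)]
    have e : ∀ a, ∑ b, ⟪pdV (pdV X b) a p, ν p⟫ * T i p a * T j p b
        = κ p j * ∑ b, gm X b a p * τ p j b * τ p i a := by
      intro a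
      rw [← Finset.sum_mul, ← mul_assoc, ← hτeig p hp, Finset.sum_mul]
      exact Finset.sum_congr rfl fun b _ => by simp only [sff, hT]; ring
    simp only [e, ← Finset.mul_sum]
    rw [Finset.sum_comm, hτorth p hp]
    by_cases hij : i = j
    · subst hij; simp
    · simp [hij, Ne.symm hij]

theorem differentiableAt_fderiv_comp {n : ℕ} {Ω : Set (Euc n)} (hΩ : IsOpen Ω) {f : Euc n → ℝ}
    (hf : ContDiffOn ℝ (⊤ : ℕ∞) f Ω) {φ : ℝ → ℝ} (hφ : Differentiable ℝ φ)
    (hφ' : Differentiable ℝ (deriv φ)) {p : Euc n} (hp : p ∈ Ω) :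
    DifferentiableAt ℝ (fderiv ℝ fun q => φ (f q)) p := by
  have d : DifferentiableAt ℝ (fun q => deriv φ (f q) • fderiv ℝ f q) p :=
    (hφ'.differentiableAt.comp p (hf.differentiableAt_of_isOpen hΩ hp)).smul
      (differentiableAt_fderiv hΩ hp hf)
  refine d.congr_of_eventuallyEq (Filter.eventuallyEq_of_mem (hΩ.mem_nhds hp) fun q hq => ?_)
  exact (hφ.differentiableAt.hasDerivAt.comp_hasFDerivAt q
    (hf.differentiableAt_of_isOpen hΩ hq).hasFDerivAt).fderiv

/-- Lemma 3.1 of the paper.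
On a connected component `Ω` of the open dense set Σ_A (where the number of distinct principal
curvatures is locally constant) of a mean convex self-expander, for 1 ≤ k < n and
φ = φ(λ_k/H) with the Spruck–Xiao cutoff φ:
Lφ = Δφ + ⟨∇φ, x⟩ + 2⟨∇φ, ∇H/H⟩
   = φ''·|∇(λ_k/H)|² + (2φ'/H)·Σ_{s≤k} Σ_{l : κ_l ≠ κ_s} |∇h_{ls}|²/(κ_s − κ_l),
where κ are the ordered principal curvatures (eigenvalues of the shape operator g⁻¹h),
τ is the adapted orthonormal eigenframe, and |∇h_{ls}|² = Σ_a (∇_{τ_a}h(τ_l,τ_s))². -/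
theorem stmt_11 {n k : ℕ} (hk1 : 1 ≤ k) (hkn : k < n)
    (X ν : Euc n → Euc (n + 1)) (Ω : Set (Euc n)) (hΩ : IsOpen Ω) (hconn : IsConnected Ω)
    (hX : ContDiff ℝ (⊤ : ℕ∞) X) (hν : ContDiff ℝ (⊤ : ℕ∞) ν)
    (himm : ∀ p ∈ Ω, IsUnit (gMat X p).det)
    (hunit : ∀ p ∈ Ω, ‖ν p‖ = 1)
    (horth : ∀ p ∈ Ω, ∀ i, ⟪ν p, pdV X i p⟫ = (0 : ℝ))
    (hexp : ∀ p ∈ Ω, meanCurv X ν p = ⟪X p, ν p⟫)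
    (hmc : ∀ p ∈ Ω, 0 < meanCurv X ν p)
    (κ : Euc n → Fin n → ℝ) (hκmono : ∀ p, Monotone (κ p))
    (hκeig : ∀ p ∈ Ω,
      (gInv X p * Matrix.of (fun i j => sff X ν i j p)).charpoly
        = ∏ i, (Polynomial.X - Polynomial.C (κ p i)))
    (hκsmooth : ∀ i, ContDiffOn ℝ (⊤ : ℕ∞) (fun p => κ p i) Ω)
    (hSigA : ∀ p ∈ Ω, ∀ᶠ q in nhds p, numDistinct κ q = numDistinct κ p)
    (τ : Euc n → Fin n → Fin n → ℝ)
    (hτsmooth : ∀ i a, ContDiffOn ℝ (⊤ : ℕ∞) (fun p => τ p i a) Ω)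
    (hτorth : ∀ p ∈ Ω, ∀ i j,
      (∑ a, ∑ b, gm X a b p * τ p i a * τ p j b) = if i = j then (1 : ℝ) else 0)
    (hτeig : ∀ p ∈ Ω, ∀ (i b : Fin n),
      (∑ a, sff X ν a b p * τ p i a) = κ p i * ∑ a, gm X a b p * τ p i a) :
    ∀ p ∈ Ω,
      Lop X ν (fun q => phiSX (ratk X ν κ k q)) p
        = deriv (deriv phiSX) (ratk X ν κ k p)
            * gradSq X (ratk X ν κ k) (ratk X ν κ k) p
          + (2 * deriv phiSX (ratk X ν κ k p) / meanCurv X ν p)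
            * ∑ s ∈ Finset.univ.filter (fun s : Fin n => s.val < k),
                ∑ l ∈ Finset.univ.filter (fun l : Fin n => κ p l ≠ κ p s),
                  (∑ a, (frameDh X ν τ a l s p) ^ 2) / (κ p s - κ p l) := by
  intro p hp
  have h := isPrincipalFrame_of_coordinates hΩ hX hν hunit horth hκsmooth hτsmooth hτorth hτeig
  have hH : ∀ q ∈ Ω, meanCurv X ν q = ∑ i, κ q i := fun q hq => h.meanCurv_eq hq
  have sf : ContDiffOn ℝ (⊤ : ℕ∞) (ratk X ν κ k) Ω :=
    (ContDiffOn.sum fun i _ => hκsmooth i).div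
      ((ContDiffOn.sum fun i _ => hκsmooth i).congr hH) fun q hq => (hmc q hq).ne'
  have main := h.drift_laplacian_comp_ratio (fun q hq => (hH q hq).symm.trans (hexp q hq)) hH hmc
    (Finset.univ.filter fun s : Fin n => s.val < k) (f := ratk X ν κ k) (fun q _ => rfl)
    differentiable_phiSX differentiable_deriv_phiSX hp
  rw [Lop, h.lapBel_add_driftTerm hp
    (differentiableAt_fderiv_comp hΩ sf differentiable_phiSX differentiable_deriv_phiSX hp),
    h.gradSq_eq hp, h.gradSq_eq hp, main]
  congr 2
  refine Finset.sum_congr rfl fun s _ => ?_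
  rw [Finset.sum_filter]
  refine Finset.sum_congr rfl fun l _ => ?_
  split_ifs with hne
  · have hls : l ≠ s := fun e => hne (by rw [e])
    have hd : κ p s - κ p l ≠ 0 := sub_ne_zero.2 hne.symm
    rw [Finset.sum_div]
    refine Finset.sum_congr rfl fun a _ => ?_
    have := h.frameDh_eq hp a l s
    rw [if_neg hls, zero_add] at this
    rw [show frameDh X ν τ a l s p = _ from this, eq_div_iff hd]
    ring
  · rw [not_not.1 hne]
    simp

end
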